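/- arXiv:1105.5067 — 2 statements merged into one kernel-verified Lean document; each statement's English description precedes it below -/
import Mathlib

section
/- Darboux's lemma on rotation and translation fields: let φ : 𝕊² → ℝ³ be a smooth immersion and ξ an isometric infinitesimal deformation of φ. Then there exists a unique pair (η, τ) of smooth maps 𝕊² → ℝ³ such that ξ x = η x × φ x + τ x for all x ∈ 𝕊² and dξ_x X = η x × dφ_x X for every x and every X ∈ T_x𝕊²; moreover this pair satisfies dτ_x X = φ x × dη_x X for every x and X. -/
noncomputable section

open scoped Manifold RealInnerProductSpace
open Metric Module

local notation "ℝ³" => EuclideanSpace ℝ (Fin 3)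

instance : Fact (finrank ℝ ℝ³ = 2 + 1) := ⟨by simp⟩

local notation "𝕊²" => sphere (0 : ℝ³) 1

/-- The cross product on `ℝ³ = EuclideanSpace ℝ (Fin 3)`. -/
def cross (a b : ℝ³) : ℝ³ :=
  (EuclideanSpace.equiv (Fin 3) ℝ).symm
    (crossProduct (EuclideanSpace.equiv (Fin 3) ℝ a) (EuclideanSpace.equiv (Fin 3) ℝ b))

/-- `f : 𝕊² → ℝ³` is smooth (`C^∞`). -/
def Smooth3 (f : 𝕊² → ℝ³) : Prop := ContMDiff (𝓡 2) 𝓘(ℝ, ℝ³) (⊤ : ℕ∞) f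

/-- The manifold derivative of `f : 𝕊² → ℝ³` at `x ∈ 𝕊²`. -/
def mfd (f : 𝕊² → ℝ³) (x : 𝕊²) : TangentSpace (𝓡 2) x →L[ℝ] ℝ³ :=
  mfderiv (𝓡 2) 𝓘(ℝ, ℝ³) f x

/-- `ν` is a unit normal field for `φ`. -/
def IsUnitNormalField (φ ν : 𝕊² → ℝ³) : Prop :=
  Smooth3 ν ∧ (∀ x, ‖ν x‖ = 1) ∧
    ∀ (x : 𝕊²) (X : TangentSpace (𝓡 2) x), ⟪ν x, mfd φ x X⟫ = 0

/-- `φ` has everywhere positive Gauss curvature with respect to `ν`. -/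
def PosGaussCurvature (φ ν : 𝕊² → ℝ³) : Prop :=
  ∀ (x : 𝕊²) (X Y : TangentSpace (𝓡 2) x), LinearIndependent ℝ ![X, Y] →
    0 < ⟪cross (mfd ν x X) (mfd ν x Y), cross (mfd φ x X) (mfd φ x Y)⟫

/-- `η` is an isogauss infinitesimal deformation of `φ` with respect to `ν`. -/
def IsIsogaussDeformation (φ ν η : 𝕊² → ℝ³) : Prop :=
  Smooth3 η ∧
    (∀ (x : 𝕊²) (X : TangentSpace (𝓡 2) x), ⟪mfd η x X, ν x⟫ = 0) ∧
    ∀ (x : 𝕊²) (X Y : TangentSpace (𝓡 2) x),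
      cross (mfd η x X) (mfd φ x Y) + cross (mfd φ x X) (mfd η x Y) = 0

/-- `ξ` is an isometric infinitesimal deformation of `φ`. -/
def IsIsometricDeformation (φ ξ : 𝕊² → ℝ³) : Prop :=
  Smooth3 ξ ∧
    ∀ (x : 𝕊²) (X Y : TangentSpace (𝓡 2) x),
      ⟪mfd ξ x X, mfd φ x Y⟫ + ⟪mfd φ x X, mfd ξ x Y⟫ = 0

/-- `η` is the rotation vector field of the isometric infinitesimal deformation `ξ` of `φ`. -/
def IsRotationField (φ ξ η : 𝕊² → ℝ³) : Prop :=
  Smooth3 η ∧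
    ∀ (x : 𝕊²) (X : TangentSpace (𝓡 2) x), mfd ξ x X = cross (η x) (mfd φ x X)

theorem cross_apply_zero (a b : ℝ³) : cross a b 0 = a 1 * b 2 - a 2 * b 1 := by
  simp [cross, crossProduct]

theorem cross_apply_one (a b : ℝ³) : cross a b 1 = a 2 * b 0 - a 0 * b 2 := by
  simp [cross, crossProduct]

theorem cross_apply_two (a b : ℝ³) : cross a b 2 = a 0 * b 1 - a 1 * b 0 := by
  simp [cross, crossProduct]

theorem inner_eq_coord (a b : ℝ³) : ⟪a, b⟫ = a 0 * b 0 + a 1 * b 1 + a 2 * b 2 := by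
  simp [PiLp.inner_apply, Fin.sum_univ_three]
  ring

/-- The cross product as a continuous bilinear map. -/
def crossL : ℝ³ →L[ℝ] ℝ³ →L[ℝ] ℝ³ :=
  LinearMap.toContinuousBilinearMap <| LinearMap.mk₂ ℝ cross
    (by intros; simp [cross]) (by intros; simp [cross])
    (by intros; simp [cross]) (by intros; simp [cross])

@[simp]
theorem crossL_apply (a b : ℝ³) : crossL a b = cross a b := rfl

theorem cross_swap (a b : ℝ³) : cross a b = -cross b a := by
  ext i
  fin_cases i <;> simp [cross_apply_zero, cross_apply_one, cross_apply_two] <;> ring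

theorem cross_ne_zero {a b : ℝ³} (h : LinearIndependent ℝ ![a, b]) : cross a b ≠ 0 := by
  have h' : LinearIndependent ℝ
      ![EuclideanSpace.equiv (Fin 3) ℝ a, EuclideanSpace.equiv (Fin 3) ℝ b] := by
    have := h.map' (EuclideanSpace.equiv (Fin 3) ℝ).toLinearEquiv.toLinearMap
      (LinearEquiv.ker _)
    refine (linearIndependent_equiv' (Equiv.refl _) ?_).mp this
    ext i j
    fin_cases i <;> rfl
  rw [cross, Ne, ContinuousLinearEquiv.map_eq_zero_iff]
  exact crossProduct_ne_zero_iff_linearIndependent.mpr h'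

/-- The vector `w` with `w × a = u` and `w × b = v`, when it exists and `a × b ≠ 0`. -/
def crossSolution (a b u v : ℝ³) : ℝ³ :=
  ⟪cross a b, cross a b⟫⁻¹ •
    (⟪v, cross a b⟫ • a - ⟪u, cross a b⟫ • b + ⟪u, b⟫ • cross a b)

theorem cross_crossSolution_left {a b u v : ℝ³} (hn : cross a b ≠ 0) (hua : ⟪u, a⟫ = 0) :
    cross (crossSolution a b u v) a = u := by
  have hn' : ⟪cross a b, cross a b⟫ ≠ 0 := inner_self_ne_zero.mpr hn
  have key : cross (⟪v, cross a b⟫ • a - ⟪u, cross a b⟫ • b + ⟪u, b⟫ • cross a b) a =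
      ⟪cross a b, cross a b⟫ • u := by
    rw [inner_eq_coord] at hua
    ext i
    fin_cases i <;>
      simp only [Fin.zero_eta, Fin.mk_one, Fin.reduceFinMk, cross_apply_zero, cross_apply_one,
        cross_apply_two, inner_eq_coord, PiLp.add_apply, PiLp.sub_apply, PiLp.smul_apply,
        smul_eq_mul]
    · linear_combination (norm := (simp only [inner_eq_coord]; ring))
        (⟪a, b⟫ * b 0 - ⟪b, b⟫ * a 0) * hua
    · linear_combination (norm := (simp only [inner_eq_coord]; ring))
        (⟪a, b⟫ * b 1 - ⟪b, b⟫ * a 1) * hua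
    · linear_combination (norm := (simp only [inner_eq_coord]; ring))
        (⟪a, b⟫ * b 2 - ⟪b, b⟫ * a 2) * hua
  rw [crossSolution, ← crossL_apply, map_smul, smul_apply, crossL_apply, key,
    inv_smul_smul₀ hn']

theorem cross_crossSolution_right {a b u v : ℝ³} (hn : cross a b ≠ 0) (hvb : ⟪v, b⟫ = 0)
    (huv : ⟪u, b⟫ + ⟪a, v⟫ = 0) : cross (crossSolution a b u v) b = v := by
  have hn' : ⟪cross a b, cross a b⟫ ≠ 0 := inner_self_ne_zero.mpr hn
  have key : cross (⟪v, cross a b⟫ • a - ⟪u, cross a b⟫ • b + ⟪u, b⟫ • cross a b) b =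
      ⟪cross a b, cross a b⟫ • v := by
    rw [inner_eq_coord] at hvb
    rw [inner_eq_coord, inner_eq_coord] at huv
    ext i
    fin_cases i <;>
      simp only [Fin.zero_eta, Fin.mk_one, Fin.reduceFinMk, cross_apply_zero, cross_apply_one,
        cross_apply_two, inner_eq_coord, PiLp.add_apply, PiLp.sub_apply, PiLp.smul_apply,
        smul_eq_mul]
    · linear_combination (norm := (simp only [inner_eq_coord]; ring))
        (⟪a, b⟫ * b 0 - ⟪b, b⟫ * a 0) * huv + (⟪a, b⟫ * a 0 - ⟪a, a⟫ * b 0) * hvb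
    · linear_combination (norm := (simp only [inner_eq_coord]; ring))
        (⟪a, b⟫ * b 1 - ⟪b, b⟫ * a 1) * huv + (⟪a, b⟫ * a 1 - ⟪a, a⟫ * b 1) * hvb
    · linear_combination (norm := (simp only [inner_eq_coord]; ring))
        (⟪a, b⟫ * b 2 - ⟪b, b⟫ * a 2) * huv + (⟪a, b⟫ * a 2 - ⟪a, a⟫ * b 2) * hvb
  rw [crossSolution, ← crossL_apply, map_smul, smul_apply, crossL_apply, key,
    inv_smul_smul₀ hn']

theorem crossSolution_cross {a b : ℝ³} (hn : cross a b ≠ 0) (w : ℝ³) :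
    crossSolution a b (cross w a) (cross w b) = w := by
  have hn' : ⟪cross a b, cross a b⟫ ≠ 0 := inner_self_ne_zero.mpr hn
  rw [crossSolution, inv_smul_eq_iff₀ hn']
  ext i
  fin_cases i <;>
    simp only [Fin.zero_eta, Fin.mk_one, Fin.reduceFinMk, cross_apply_zero, cross_apply_one,
      cross_apply_two, inner_eq_coord, PiLp.add_apply, PiLp.sub_apply, PiLp.smul_apply,
      smul_eq_mul] <;>
    ring

theorem contDiffAt_crossSolution {E : Type*} [NormedAddCommGroup E] [NormedSpace ℝ E]
    {n : WithTop ℕ∞} {a b u v : E → ℝ³} {y : E} (ha : ContDiffAt ℝ n a y)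
    (hb : ContDiffAt ℝ n b y) (hu : ContDiffAt ℝ n u y) (hv : ContDiffAt ℝ n v y)
    (hn : cross (a y) (b y) ≠ 0) :
    ContDiffAt ℝ n (fun z ↦ crossSolution (a z) (b z) (u z) (v z)) y := by
  have hc : ContDiffAt ℝ n (fun z ↦ cross (a z) (b z)) y :=
    (crossL.contDiff.contDiffAt.comp y ha).clm_apply hb
  exact ((hc.inner ℝ hc).inv (inner_self_ne_zero.mpr hn)).smul
    ((((hv.inner ℝ hc).smul ha).sub ((hu.inner ℝ hc).smul hb)).add ((hu.inner ℝ hb).smul hc))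

local notation "ℝ²" => EuclideanSpace ℝ (Fin 2)

/-- The vector `w` with `w × A X = U X` for all `X`, when it exists and `A` is injective. -/
def rotationVector (A U : ℝ² →L[ℝ] ℝ³) : ℝ³ :=
  crossSolution (A (EuclideanSpace.single 0 1)) (A (EuclideanSpace.single 1 1))
    (U (EuclideanSpace.single 0 1)) (U (EuclideanSpace.single 1 1))

theorem cross_map_single_ne_zero {A : ℝ² →L[ℝ] ℝ³} (hA : Function.Injective A) :
    cross (A (EuclideanSpace.single 0 1)) (A (EuclideanSpace.single 1 1)) ≠ 0 := by
  refine cross_ne_zero ?_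
  have h := (EuclideanSpace.basisFun (Fin 2) ℝ).toBasis.linearIndependent.map'
    (A : ℝ² →ₗ[ℝ] ℝ³) (LinearMap.ker_eq_bot.mpr hA)
  refine (linearIndependent_equiv' (Equiv.refl _) ?_).mp h
  ext i j
  fin_cases i <;> simp

theorem cross_rotationVector {A U : ℝ² →L[ℝ] ℝ³} (hA : Function.Injective A)
    (h : ∀ X Y, ⟪U X, A Y⟫ + ⟪A X, U Y⟫ = 0) (X : ℝ²) :
    cross (rotationVector A U) (A X) = U X := by
  have hself (Y : ℝ²) : ⟪U Y, A Y⟫ = 0 := by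
    have := h Y Y
    rw [real_inner_comm (U Y)] at this
    linarith
  have hn := cross_map_single_ne_zero hA
  suffices (crossL (rotationVector A U)).comp A = U from DFunLike.congr_fun this X
  refine ContinuousLinearMap.coe_injective
    ((EuclideanSpace.basisFun (Fin 2) ℝ).toBasis.ext fun i ↦ ?_)
  fin_cases i
  · simpa using! cross_crossSolution_left hn (hself _)
  · simpa using! cross_crossSolution_right hn (hself _) (h _ _)

theorem eq_rotationVector {A U : ℝ² →L[ℝ] ℝ³} (hA : Function.Injective A) {w : ℝ³}
    (h : ∀ X, U X = cross w (A X)) : w = rotationVector A U := by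
  rw [rotationVector, h, h, crossSolution_cross (cross_map_single_ne_zero hA)]

theorem Smooth3.contDiffOn_comp_extChartAt_symm {f : 𝕊² → ℝ³} (hf : Smooth3 f) (x₀ : 𝕊²) :
    ContDiffOn ℝ (⊤ : ℕ∞) (f ∘ (extChartAt (𝓡 2) x₀).symm) (extChartAt (𝓡 2) x₀).target :=
  (ContMDiff.comp_contMDiffOn hf (contMDiffOn_extChartAt_symm x₀)).contDiffOn

theorem Smooth3.contDiffAt_comp_extChartAt_symm {f : 𝕊² → ℝ³} (hf : Smooth3 f) {x₀ x : 𝕊²}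
    (hx : x ∈ (extChartAt (𝓡 2) x₀).source) :
    ContDiffAt ℝ (⊤ : ℕ∞) (f ∘ (extChartAt (𝓡 2) x₀).symm) (extChartAt (𝓡 2) x₀ x) :=
  (hf.contDiffOn_comp_extChartAt_symm x₀).contDiffAt
    ((isOpen_extChartAt_target x₀).mem_nhds ((extChartAt (𝓡 2) x₀).map_source hx))

/-- A chart around `x` identifies manifold derivatives at `x` with Fréchet derivatives. -/
theorem exists_equiv_fderiv_comp_extChartAt_symm {x₀ x : 𝕊²}
    (hx : x ∈ (extChartAt (𝓡 2) x₀).source) :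
    ∃ L : ℝ² ≃L[ℝ] TangentSpace (𝓡 2) x, ∀ f : 𝕊² → ℝ³, Smooth3 f → ∀ v,
      fderiv ℝ (f ∘ (extChartAt (𝓡 2) x₀).symm) (extChartAt (𝓡 2) x₀ x) v = mfd f x (L v) := by
  have hy : extChartAt (𝓡 2) x₀ x ∈ (extChartAt (𝓡 2) x₀).target :=
    (extChartAt (𝓡 2) x₀).map_source hx
  have hyx : (extChartAt (𝓡 2) x₀).symm (extChartAt (𝓡 2) x₀ x) = x :=
    (extChartAt (𝓡 2) x₀).left_inv hx
  obtain ⟨L, hL⟩ := isInvertible_mfderivWithin_extChartAt_symm (I := 𝓡 2) hy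
  rw [ModelWithCorners.range_eq_univ, mfderivWithin_univ] at hL
  have hsymm : MDifferentiableAt 𝓘(ℝ, ℝ²) (𝓡 2) (extChartAt (𝓡 2) x₀).symm
      (extChartAt (𝓡 2) x₀ x) :=
    ((contMDiffOn_extChartAt_symm (n := 1) x₀).contMDiffAt
      ((isOpen_extChartAt_target x₀).mem_nhds hy)).mdifferentiableAt one_ne_zero
  generalize extChartAt (𝓡 2) x₀ x = y at *
  subst hyx
  refine ⟨L, fun f hf v ↦ ?_⟩
  rw [← mfderiv_eq_fderiv, mfderiv_comp (I' := 𝓡 2) y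
    (ContMDiff.mdifferentiable hf (by simp) _) hsymm, ← hL]
  rfl

/-- The rotation field of a deformation `ξ` of `φ`. -/
def rotationField (φ ξ : 𝕊² → ℝ³) (x : 𝕊²) : ℝ³ :=
  rotationVector (mfd φ x) (mfd ξ x)

theorem isRotationField_rotationField {φ ξ : 𝕊² → ℝ³} (hφ : Smooth3 φ)
    (hφimm : ∀ x : 𝕊², Function.Injective (mfd φ x)) (hξ : IsIsometricDeformation φ ξ) :
    IsRotationField φ ξ (rotationField φ ξ) := by
  have hrot (x : 𝕊²) (X : TangentSpace (𝓡 2) x) :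
      mfd ξ x X = cross (rotationField φ ξ x) (mfd φ x X) :=
    (cross_rotationVector (hφimm x) (hξ.2 x) X).symm
  refine ⟨fun x₀ ↦ ?_, hrot⟩
  set e := extChartAt (𝓡 2) x₀
  have hx₀ : x₀ ∈ e.source := mem_extChartAt_source x₀
  have hinj {x : 𝕊²} (hx : x ∈ e.source) :
      Function.Injective (fderiv ℝ (φ ∘ e.symm) (e x)) := by
    obtain ⟨L, hL⟩ := exists_equiv_fderiv_comp_extChartAt_symm hx
    intro v w hvw
    rw [hL φ hφ, hL φ hφ] at hvw
    exact L.injective (hφimm x hvw)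
  have heq : rotationField φ ξ =ᶠ[nhds x₀]
      (fun y ↦ rotationVector (fderiv ℝ (φ ∘ e.symm) y) (fderiv ℝ (ξ ∘ e.symm) y)) ∘ e := by
    filter_upwards [extChartAt_source_mem_nhds (I := 𝓡 2) x₀] with x hx
    obtain ⟨L, hL⟩ := exists_equiv_fderiv_comp_extChartAt_symm hx
    refine eq_rotationVector (hinj hx) fun v ↦ ?_
    rw [hL φ hφ, hL ξ hξ.1, hrot]
  refine ContMDiffAt.congr_of_eventuallyEq ?_ heq
  refine ContMDiffAt.comp x₀ (ContDiffAt.contMDiffAt ?_) contMDiffAt_extChartAt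
  have hd {f : 𝕊² → ℝ³} (hf : Smooth3 f) (v : ℝ²) :
      ContDiffAt ℝ (⊤ : ℕ∞) (fun y ↦ fderiv ℝ (f ∘ e.symm) y v) (e x₀) :=
    ((hf.contDiffAt_comp_extChartAt_symm hx₀).fderiv_right (by simp)).clm_apply contDiffAt_const
  exact contDiffAt_crossSolution (hd hφ _) (hd hφ _) (hd hξ.1 _) (hd hξ.1 _)
    (cross_map_single_ne_zero (hinj hx₀))

theorem Smooth3.cross {f g : 𝕊² → ℝ³} (hf : Smooth3 f) (hg : Smooth3 g) :
    Smooth3 fun x ↦ cross (f x) (g x) :=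
  ContMDiff.clm_apply (crossL.contDiff.contMDiff.comp hf) hg

theorem mfd_cross {f g : 𝕊² → ℝ³} (hf : Smooth3 f) (hg : Smooth3 g) (x : 𝕊²)
    (X : TangentSpace (𝓡 2) x) :
    mfd (fun x ↦ _root_.cross (f x) (g x)) x X =
      _root_.cross (f x) (mfd g x X) + _root_.cross (mfd f x X) (g x) := by
  have hx : x ∈ (extChartAt (𝓡 2) x).source := mem_extChartAt_source x
  obtain ⟨L, hL⟩ := exists_equiv_fderiv_comp_extChartAt_symm hx
  obtain ⟨v, rfl⟩ := L.surjective X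
  have hd {h : 𝕊² → ℝ³} (hh : Smooth3 h) :
      HasFDerivAt (h ∘ (extChartAt (𝓡 2) x).symm)
        (fderiv ℝ (h ∘ (extChartAt (𝓡 2) x).symm) (extChartAt (𝓡 2) x x))
        (extChartAt (𝓡 2) x x) :=
    ((hh.contDiffAt_comp_extChartAt_symm hx).differentiableAt (by simp)).hasFDerivAt
  have key := DFunLike.congr_fun (crossL.hasFDerivAt_of_bilinear (hd hf) (hd hg)).fderiv v
  have h := hL _ (hf.cross hg) v
  rw [← h, ← hL f hf, ← hL g hg]
  refine key.trans ?_
  simp [ContinuousLinearMap.precompR_apply, ContinuousLinearMap.precompL_apply]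

theorem mfd_sub {f g : 𝕊² → ℝ³} (hf : Smooth3 f) (hg : Smooth3 g) (x : 𝕊²)
    (X : TangentSpace (𝓡 2) x) : mfd (f - g) x X = mfd f x X - mfd g x X :=
  DFunLike.congr_fun (mfderiv_sub (ContMDiff.mdifferentiable hf (by simp) x)
    (ContMDiff.mdifferentiable hg (by simp) x)) X

/-- **Darboux's lemma**: every isometric infinitesimal deformation `ξ` of an immersed
surface has a unique pair `(η, τ)` of rotation and translation vector fields, with
`ξ = η × φ + τ` and `dξ = η × dφ`; moreover `dτ = φ × dη`. -/
theorem darboux_rotation_translation_fields (φ ξ : 𝕊² → ℝ³)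
    (hφ : Smooth3 φ) (hφimm : ∀ x : 𝕊², Function.Injective (mfd φ x))
    (hξ : IsIsometricDeformation φ ξ) :
    (∃! p : (𝕊² → ℝ³) × (𝕊² → ℝ³),
        Smooth3 p.1 ∧ Smooth3 p.2 ∧
        (∀ x : 𝕊², ξ x = cross (p.1 x) (φ x) + p.2 x) ∧
        (∀ (x : 𝕊²) (X : TangentSpace (𝓡 2) x), mfd ξ x X = cross (p.1 x) (mfd φ x X))) ∧
      ∀ p : (𝕊² → ℝ³) × (𝕊² → ℝ³),
        Smooth3 p.1 → Smooth3 p.2 →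
        (∀ x : 𝕊², ξ x = cross (p.1 x) (φ x) + p.2 x) →
        (∀ (x : 𝕊²) (X : TangentSpace (𝓡 2) x), mfd ξ x X = cross (p.1 x) (mfd φ x X)) →
        ∀ (x : 𝕊²) (X : TangentSpace (𝓡 2) x), mfd p.2 x X = cross (φ x) (mfd p.1 x X) := by
  have hη := isRotationField_rotationField hφ hφimm hξ
  refine ⟨⟨(rotationField φ ξ, fun x ↦ ξ x - cross (rotationField φ ξ x) (φ x)),
    ⟨hη.1, ContMDiff.sub hξ.1 (hη.1.cross hφ), fun x ↦ by simp, hη.2⟩, ?_⟩, ?_⟩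
  · rintro ⟨η, τ⟩ ⟨-, -, hsum, hrot⟩
    obtain rfl : η = rotationField φ ξ :=
      funext fun x ↦ eq_rotationVector (hφimm x) (hrot x)
    exact Prod.ext rfl (funext fun x ↦ eq_sub_of_add_eq' (hsum x).symm)
  · rintro ⟨η, τ⟩ hsmooth - hsum hrot x X
    have hτ : τ = ξ - fun x ↦ cross (η x) (φ x) :=
      funext fun x ↦ eq_sub_of_add_eq' (hsum x).symm
    dsimp only at hsmooth hrot ⊢
    rw [hτ, mfd_sub hξ.1 (hsmooth.cross hφ), mfd_cross hsmooth hφ, hrot, sub_add_cancel_left,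
      ← cross_swap]
end
end

section
/- Let φ : 𝕊² → ℝ³ be a smooth immersion, ξ an isometric infinitesimal deformation of φ, and η the rotation vector field of ξ. Then for every x ∈ 𝕊² and every X ∈ T_x𝕊², the vector dη_x X lies in the tangent plane dφ_x(T_x𝕊²), i.e. dη_x X belongs to the range of dφ_x. -/
noncomputable section

open scoped Manifold RealInnerProductSpace
open Metric Module

local notation "ℝ³" => EuclideanSpace ℝ (Fin 3)

local notation "𝕊²" => sphere (0 : ℝ³) 1

lemma cross_eq (a b : ℝ³) :
    cross a b = !₂[a 1 * b 2 - a 2 * b 1, a 2 * b 0 - a 0 * b 2, a 0 * b 1 - a 1 * b 0] := by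
  ext i
  fin_cases i <;> simp [cross, cross_apply]

/-- The cross product on `ℝ³` as a continuous bilinear map. -/
def crossCLM : ℝ³ →L[ℝ] ℝ³ →L[ℝ] ℝ³ :=
  (LinearMap.mk₂ ℝ cross
    (fun _ _ _ => by simp [cross]) (fun _ _ _ => by simp [cross])
    (fun _ _ _ => by simp [cross]) (fun _ _ _ => by simp [cross])).toContinuousBilinearMap

lemma crossCLM_apply (a b : ℝ³) : crossCLM a b = cross a b := rfl

lemma cross_ne_zero_of_linearIndependent {p q : ℝ³} (h : LinearIndependent ℝ ![p, q]) :
    cross p q ≠ 0 := by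
  let L := EuclideanSpace.equiv (Fin 3) ℝ
  have hL : LinearIndependent ℝ ![L p, L q] := by
    have he : ![L p, L q] = L.toLinearMap ∘ ![p, q] := by
      ext i : 1
      fin_cases i <;> rfl
    rw [he]
    exact h.map' L.toLinearMap (LinearMap.ker_eq_bot.2 L.injective)
  exact fun h0 => crossProduct_ne_zero_iff_linearIndependent.2 hL (L.symm.map_eq_zero_iff.1 h0)

lemma norm_sq_smul_eq_of_inner_cross_eq_zero {p q h : ℝ³} (hh : ⟪cross p q, h⟫ = 0) :
    (‖cross p q‖ ^ 2) • h
      = ⟪cross q (cross p q), h⟫ • p + ⟪cross (cross p q) p, h⟫ • q := by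
  have key : (‖cross p q‖ ^ 2) • h = ⟪cross q (cross p q), h⟫ • p
      + ⟪cross (cross p q) p, h⟫ • q + ⟪cross p q, h⟫ • cross p q := by
    rw [← real_inner_self_eq_norm_sq]
    simp only [cross_eq, PiLp.inner_apply, Fin.sum_univ_three]
    ext i
    fin_cases i <;> simp <;> ring
  rw [key, hh, zero_smul, add_zero]

lemma inner_cross_eq_zero_of_cross_comm {p q u v : ℝ³} (h : cross v p = cross u q) :
    ⟪cross p q, u⟫ = 0 := by
  have h0 : ⟪cross v p, p⟫ = 0 := by
    simp [cross_eq, PiLp.inner_apply, Fin.sum_univ_three]; ring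
  rw [h] at h0
  simp only [cross_eq, PiLp.inner_apply, Fin.sum_univ_three] at h0 ⊢
  simp at h0 ⊢
  linear_combination -h0

/-- If `B : ℝ² → ℝ³` satisfies `B b × A a = B a × A b` for an injective `A`, then `B` takes values
in the range of `A`. -/
lemma mem_range_of_cross_comm (A B : EuclideanSpace ℝ (Fin 2) →ₗ[ℝ] ℝ³)
    (hA : Function.Injective A) (h : ∀ a b, cross (B b) (A a) = cross (B a) (A b))
    (a : EuclideanSpace ℝ (Fin 2)) : B a ∈ LinearMap.range A := by
  let e := (EuclideanSpace.basisFun (Fin 2) ℝ).toBasis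
  have hli : LinearIndependent ℝ ![A (e 0), A (e 1)] := by
    have he : ![A (e 0), A (e 1)] = A ∘ e := by
      ext i : 1
      fin_cases i <;> rfl
    rw [he]
    exact e.linearIndependent.map' A (LinearMap.ker_eq_bot.2 hA)
  have hne := cross_ne_zero_of_linearIndependent hli
  have hmem : ∀ u : ℝ³, ⟪cross (A (e 0)) (A (e 1)), u⟫ = 0 → u ∈ LinearMap.range A := by
    intro u hu
    have hc : ‖cross (A (e 0)) (A (e 1))‖ ^ 2 ≠ 0 := by simpa using hne
    rw [← Submodule.smul_mem_iff _ hc, norm_sq_smul_eq_of_inner_cross_eq_zero hu]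
    exact add_mem (Submodule.smul_mem _ _ ⟨_, rfl⟩) (Submodule.smul_mem _ _ ⟨_, rfl⟩)
  have h1 : ⟪cross (A (e 1)) (A (e 0)), B (e 1)⟫ = 0 :=
    inner_cross_eq_zero_of_cross_comm (h (e 1) (e 0))
  rw [← e.sum_repr a, map_sum]
  refine sum_mem fun i _ => ?_
  rw [map_smul]
  refine Submodule.smul_mem _ _ (hmem _ ?_)
  fin_cases i
  · exact inner_cross_eq_zero_of_cross_comm (h (e 0) (e 1))
  · have hs : cross (A (e 0)) (A (e 1)) = -cross (A (e 1)) (A (e 0)) := by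
      ext i
      fin_cases i <;> simp [cross_eq] <;> ring
    simpa [hs] using h1

/-- Equality of mixed second derivatives applied to `dΞ = H × dΦ`. -/
lemma cross_fderiv_comm {E : Type*} [NormedAddCommGroup E] [NormedSpace ℝ E]
    {Φ Ξ H : E → ℝ³} (hΦ : ContDiff ℝ 2 Φ) (hΞ : ContDiff ℝ 2 Ξ) (hH : Differentiable ℝ H)
    (h : ∀ u a, fderiv ℝ Ξ u a = cross (H u) (fderiv ℝ Φ u a)) (u a b : E) :
    cross (fderiv ℝ H u b) (fderiv ℝ Φ u a) = cross (fderiv ℝ H u a) (fderiv ℝ Φ u b) := by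
  have hsymm {F : E → ℝ³} (hF : ContDiff ℝ 2 F) :
      fderiv ℝ (fderiv ℝ F) u a b = fderiv ℝ (fderiv ℝ F) u b a :=
    (hF.contDiffAt.isSymmSndFDerivAt (by simp)).eq a b
  have hd {F : E → ℝ³} (hF : ContDiff ℝ 2 F) (c : E) :
      HasFDerivAt (fun v => fderiv ℝ F v c) ((fderiv ℝ (fderiv ℝ F) u).flip c) u := by
    have := ((hF.fderiv_right (m := 1) le_rfl).differentiable one_ne_zero u).hasFDerivAt
    simpa using this.clm_apply (hasFDerivAt_const c u)
  have key (c d : E) : fderiv ℝ (fderiv ℝ Ξ) u d c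
      = cross (H u) (fderiv ℝ (fderiv ℝ Φ) u d c) + cross (fderiv ℝ H u d) (fderiv ℝ Φ u c) := by
    have h1 := crossCLM.hasFDerivAt_of_bilinear (hH u).hasFDerivAt (hd hΦ c)
    have h2 := hd hΞ c
    simp only [crossCLM_apply, ← h] at h1
    simpa [crossCLM_apply] using congrArg (fun L => L d) (h2.unique h1)
  have h1 := key a b
  rw [← hsymm hΞ, key b a, hsymm hΦ] at h1
  exact (add_left_cancel h1).symm

lemma contMDiff_extChartAt_symm_sphere (x : 𝕊²) :
    ContMDiff 𝓘(ℝ, EuclideanSpace ℝ (Fin 2)) (𝓡 2) (⊤ : ℕ∞) (extChartAt (𝓡 2) x).symm := by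
  have ht : (extChartAt (𝓡 2) x).target = Set.univ := by
    simp [chartAt, ChartedSpace.chartAt]
  rw [← contMDiffOn_univ, ← ht]
  exact contMDiffOn_extChartAt_symm x

lemma Smooth3.contDiff_comp_extChartAt_symm {f : 𝕊² → ℝ³} (hf : Smooth3 f) (x : 𝕊²) :
    ContDiff ℝ (⊤ : ℕ∞) (f ∘ (extChartAt (𝓡 2) x).symm) :=
  (ContMDiff.comp hf (contMDiff_extChartAt_symm_sphere x)).contDiff

lemma Smooth3.fderiv_comp_extChartAt_symm {f : 𝕊² → ℝ³} (hf : Smooth3 f) (x : 𝕊²)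
    (u a : EuclideanSpace ℝ (Fin 2)) :
    fderiv ℝ (f ∘ (extChartAt (𝓡 2) x).symm) u a
      = mfd f ((extChartAt (𝓡 2) x).symm u)
        (mfderiv 𝓘(ℝ, EuclideanSpace ℝ (Fin 2)) (𝓡 2) (extChartAt (𝓡 2) x).symm u a) := by
  rw [← mfderiv_eq_fderiv, mfderiv_comp u (hf.mdifferentiable (by simp) _)
    ((contMDiff_extChartAt_symm_sphere x).mdifferentiable (by simp) _)]
  rfl

lemma Smooth3.mfd_eq_fderiv {f : 𝕊² → ℝ³} (hf : Smooth3 f) (x : 𝕊²) :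
    mfd f x = fderiv ℝ (f ∘ (extChartAt (𝓡 2) x).symm) (extChartAt (𝓡 2) x x) := by
  have hd : MDifferentiableAt (𝓡 2) 𝓘(ℝ, ℝ³) f x := hf.mdifferentiable (by simp) x
  refine (if_pos hd).trans ?_
  rw [ModelWithCorners.range_eq_univ, fderivWithin_univ]
  rfl

/-- The differential of the rotation vector field of an isometric infinitesimal
deformation maps tangent vectors into the tangent plane of the surface. -/
theorem deta_mem_tangent_plane (φ ξ η : 𝕊² → ℝ³)
    (hφ : Smooth3 φ) (hφimm : ∀ x : 𝕊², Function.Injective (mfd φ x))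
    (hξ : IsIsometricDeformation φ ξ)
    (hη : IsRotationField φ ξ η) :
    ∀ (x : 𝕊²) (X : TangentSpace (𝓡 2) x), mfd η x X ∈ Set.range (mfd φ x) := by
  intro x X
  have hcomm := cross_fderiv_comm
    (contDiff_infty.1 (hφ.contDiff_comp_extChartAt_symm x) 2)
    (contDiff_infty.1 (hξ.1.contDiff_comp_extChartAt_symm x) 2)
    ((hη.1.contDiff_comp_extChartAt_symm x).differentiable (by simp))
    (fun u a => by
      rw [hξ.1.fderiv_comp_extChartAt_symm, hφ.fderiv_comp_extChartAt_symm, hη.2]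
      rfl)
    (extChartAt (𝓡 2) x x)
  rw [← hφ.mfd_eq_fderiv, ← hη.1.mfd_eq_fderiv] at hcomm
  exact mem_range_of_cross_comm (mfd φ x).toLinearMap (mfd η x).toLinearMap (hφimm x) hcomm X
end
end
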